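/- Let T be a forest, let v be a stem of T that has a non-leaf neighbor, let R be the set of leaf neighbors of v, and let r = |R| ≥ 1. If r+1 is not a triangular number, then χ_ISC(T) = χ_ISC(T − R − v) + r + u_r + 1. -/

import Mathlib

variable {V : Type} [Fintype V] [DecidableEq V]

/-- The `k`-th triangular number `t_k = C(k+1,2)`. -/
def tri (k : ℕ) : ℕ := (k + 1).choose 2

/-- A natural number is triangular if it equals `t_k` for some `k`. -/
def IsTriangular (m : ℕ) : Prop := ∃ k, m = tri k

/-- `uval r = max {k : t_k ≤ r}`. -/
def uval (r : ℕ) : ℕ := Nat.findGreatest (fun k => tri k ≤ r) r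

/-- The lists `L` admit a proper coloring of the subgraph of `G` induced by `S`,
with each vertex of `S` colored from its list. -/
def ColorableOn (G : SimpleGraph V) (S : Finset V) (L : V → Finset ℕ) : Prop :=
  ∃ φ : V → ℕ, (∀ v ∈ S, φ v ∈ L v) ∧ ∀ x ∈ S, ∀ y ∈ S, G.Adj x y → φ x ≠ φ y

/-- In the interactive sum choice game on the subgraph of `G` induced by `S`, starting
from lists `L`, Requester can force the game to end within `n` further rounds: either the
current lists already admit a proper coloring, or Requester can request a new color at
some vertex `v ∈ S` so that, whatever color `c ∉ L v` Supplier adds to `L v`, Requester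
can finish within `n - 1` further rounds. -/
def ReqWins (G : SimpleGraph V) (S : Finset V) : (V → Finset ℕ) → ℕ → Prop
  | L, 0 => ColorableOn G S L
  | L, n + 1 => ColorableOn G S L ∨
      ∃ v ∈ S, ∀ c ∉ L v, ReqWins G S (Function.update L v (insert c (L v))) n

/-- The interactive sum choice number of the subgraph of `G` induced by `S`:
the optimal number of rounds of the interactive sum choice game, namely the least `n`
such that Requester can force the game, started from empty lists, to end within `n`
rounds. -/
noncomputable def isc (G : SimpleGraph V) (S : Finset V) : ℕ :=
  sInf {n | ReqWins G S (fun _ => ∅) n}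

/-- A vertex is a leaf if it has exactly one neighbor. -/
def IsLeaf (G : SimpleGraph V) (v : V) : Prop := (G.neighborSet v).ncard = 1

/-- A stem in a forest: a vertex with at least one leaf neighbor and at most one
non-leaf neighbor. -/
def IsStem (G : SimpleGraph V) (v : V) : Prop :=
  (∃ w, G.Adj v w ∧ IsLeaf G w) ∧ {w | G.Adj v w ∧ ¬ IsLeaf G w}.ncard ≤ 1

theorem tri_succ (k : ℕ) : tri (k + 1) = tri k + (k + 1) := by
  unfold tri
  rw [Nat.choose_succ_succ (k + 1) 1, Nat.choose_one_right]
  ring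

theorem le_tri (k : ℕ) : k ≤ tri k := by
  induction k with
  | zero => simp
  | succ k ih => rw [tri_succ]; omega

theorem tri_uval_le (r : ℕ) : tri (uval r) ≤ r :=
  Nat.findGreatest_spec (P := fun k => tri k ≤ r) (Nat.zero_le r) (by simp [tri])

theorem card_lt_tri_uval_succ (r : ℕ) : r < tri (uval r + 1) := by
  by_contra! h
  have := Nat.le_findGreatest (P := fun k => tri k ≤ r) ((le_tri _).trans h) h
  unfold uval at this
  omega

set_option linter.unusedSectionVars false

variable {G : SimpleGraph V} {S : Finset V} {L L' : V → Finset ℕ} {m n : ℕ}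

theorem ColorableOn.mono (h : ColorableOn G S L) (hL : ∀ x ∈ S, L x ⊆ L' x) :
    ColorableOn G S L' := by
  obtain ⟨φ, h1, h2⟩ := h
  exact ⟨φ, fun x hx => hL x hx (h1 x hx), h2⟩

theorem ColorableOn.subset {S' : Finset V} (h : ColorableOn G S L) (hS : S' ⊆ S) :
    ColorableOn G S' L := by
  obtain ⟨φ, h1, h2⟩ := h
  exact ⟨φ, fun x hx => h1 x (hS hx), fun x hx y hy => h2 x (hS hx) y (hS hy)⟩

theorem ColorableOn.reqWins (h : ColorableOn G S L) : ReqWins G S L n := by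
  cases n with
  | zero => exact h
  | succ n => exact Or.inl h

theorem ReqWins.succ (h : ReqWins G S L n) : ReqWins G S L (n + 1) := by
  induction n generalizing L with
  | zero => exact Or.inl h
  | succ n ih =>
    rcases h with h | ⟨x, hx, h⟩
    · exact Or.inl h
    · exact Or.inr ⟨x, hx, fun c hc => ih (h c hc)⟩

theorem ReqWins.mono (h : ReqWins G S L m) (hmn : m ≤ n) : ReqWins G S L n := by
  induction hmn with
  | refl => exact h
  | step _ ih => exact ih.succ

theorem ReqWins.congr (h : ReqWins G S L n) (hL : ∀ x ∈ S, L x = L' x) :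
    ReqWins G S L' n := by
  induction n generalizing L L' with
  | zero => exact ColorableOn.mono h fun x hx => (hL x hx).subset
  | succ n ih =>
    rcases h with h | ⟨x, hx, h⟩
    · exact Or.inl (h.mono fun x hx => (hL x hx).subset)
    · refine Or.inr ⟨x, hx, fun c hc => ih (h c (by rwa [hL x hx])) fun y hy => ?_⟩
      by_cases hyx : y = x
      · subst hyx; simp [hL y hy]
      · simp [hyx, hL y hy]

/-- A proper coloring exists if all lists have at least as many colors as there are vertices. -/
theorem colorableOn_of_card_le (h : ∀ x ∈ S, Fintype.card V ≤ (L x).card) :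
    ColorableOn G S L := by
  classical
  obtain ⟨f, hinj, hf⟩ := (Finset.all_card_le_biUnion_card_iff_exists_injective
    (fun x : S => L x)).1 (by
      intro s
      rcases s.eq_empty_or_nonempty with rfl | ⟨x, hx⟩
      · simp
      · calc s.card ≤ Fintype.card S := s.card_le_univ
          _ ≤ Fintype.card V := by simpa using S.card_le_univ
          _ ≤ (L x).card := h x x.2
          _ ≤ _ := Finset.card_le_card (Finset.subset_biUnion_of_mem (fun x : S => L x) hx))
  refine ⟨fun x => if hx : x ∈ S then f ⟨x, hx⟩ else 0, fun x hx => ?_, fun x hx y hy hxy he => ?_⟩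
  · simpa [hx] using hf ⟨x, hx⟩
  · simp only [hx, hy, dif_pos] at he
    exact hxy.ne (congrArg Subtype.val (hinj he))

theorem reqWins_of_sum_le (h : ∑ x ∈ S, (Fintype.card V - (L x).card) ≤ n) :
    ReqWins G S L n := by
  induction n generalizing L with
  | zero =>
    refine colorableOn_of_card_le fun x hx => ?_
    have := Finset.sum_eq_zero_iff.1 (Nat.le_zero.1 h) x hx
    omega
  | succ n ih =>
    by_cases hc : ∀ x ∈ S, Fintype.card V ≤ (L x).card
    · exact (colorableOn_of_card_le hc).reqWins
    · push Not at hc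
      obtain ⟨x, hx, hlt⟩ := hc
      refine Or.inr ⟨x, hx, fun c hc => ih ?_⟩
      rw [← Nat.lt_succ_iff]
      refine lt_of_lt_of_le (Finset.sum_lt_sum (fun y _ => ?_) ⟨x, hx, ?_⟩) h
      · by_cases hyx : y = x
        · subst hyx; simp [hc]; omega
        · simp [hyx]
      · simp [hc]; omega

theorem reqWins_isc (G : SimpleGraph V) (S : Finset V) :
    ReqWins G S (fun _ => ∅) (isc G S) :=
  Nat.sInf_mem (s := {n | ReqWins G S (fun _ => ∅) n}) ⟨_, reqWins_of_sum_le le_rfl⟩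

/-- Requester may first request one color at every vertex of a set of vertices with empty lists. -/
theorem reqWins_add_card (A : Finset V) (hA : A ⊆ S) (L : V → Finset ℕ)
    (hL : ∀ x ∈ A, L x = ∅)
    (h : ∀ d : V → ℕ, ReqWins G S (fun x => if x ∈ A then {d x} else L x) n) :
    ReqWins G S L (n + A.card) := by
  induction A using Finset.induction_on generalizing L with
  | empty => simpa using h (fun _ => 0)
  | insert a A ha ih =>
    rw [Finset.card_insert_of_notMem ha, ← add_assoc]
    refine Or.inr ⟨a, hA (Finset.mem_insert_self a A), fun c _ => ?_⟩
    refine ih (fun x hx => hA (Finset.mem_insert_of_mem hx)) _ (fun x hx => ?_) fun d => ?_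
    · rw [Function.update_of_ne (by rintro rfl; exact ha hx), hL x (Finset.mem_insert_of_mem hx)]
    · refine (h (Function.update d a c)).congr fun x _ => ?_
      by_cases hxa : x = a
      · subst hxa; simp [ha, hL x (Finset.mem_insert_self x A)]
      · simp [hxa]

/-- Requester may follow a winning strategy on the subgraph induced by `S'`, ignoring the colors
in `F x ⊆ L x`, before continuing on the subgraph induced by `S`. -/
theorem ReqWins.add_of_sdiff {S' : Finset V} (hS : S' ⊆ S) {F : V → Finset ℕ}
    (hF : ∀ x, F x ⊆ L x) (h : ReqWins G S' (fun x => L x \ F x) m)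
    (hcont : ∀ L' : V → Finset ℕ, (∀ x ∉ S', L' x = L x) →
      ColorableOn G S' (fun x => L' x \ F x) → ReqWins G S L' n) :
    ReqWins G S L (m + n) := by
  induction m generalizing L with
  | zero => simpa using hcont L (fun _ _ => rfl) h
  | succ m ih =>
    rcases h with h | ⟨x, hx, h⟩
    · exact (hcont L (fun _ _ => rfl) h).mono (by omega)
    · rw [Nat.add_right_comm]
      refine Or.inr ⟨x, hS hx, fun c hc => ih (fun y => ?_) ?_ fun L' hL' hcol =>
        hcont L' (fun y hy => ?_) hcol⟩
      · by_cases hyx : y = x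
        · subst hyx; simpa using (hF y).trans (Finset.subset_insert _ _)
        · simpa [hyx] using hF y
      · refine (h c (by simp [hc])).congr fun y _ => ?_
        by_cases hyx : y = x
        · subst hyx
          simp [Finset.insert_sdiff_of_notMem _ (fun h => hc (hF y h))]
        · simp [hyx]
      · rw [hL' y hy, Function.update_of_ne (by rintro rfl; exact hy hx)]

/-- At the cost of one additional round, Requester can win on the subgraph induced by `S'` with
the color `e` forbidden at the vertex `w`. -/
theorem ReqWins.add_of_notMem {S' : Finset V} (hS : S' ⊆ S) {w : V} {e : ℕ}
    (hw : e ∉ L w) (h : ReqWins G S' L m)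
    (hcont : ∀ L' : V → Finset ℕ, (∀ x ∉ S', L' x = L x) →
      ColorableOn G S' (fun x => L' x \ if x = w then {e} else ∅) → ReqWins G S L' n) :
    ReqWins G S L (m + 1 + n) := by
  have hE : ∀ L : V → Finset ℕ, e ∉ L w → ∀ x, L x = L x \ if x = w then {e} else ∅ := by
    intro L hL x
    by_cases hx : x = w
    · subst hx; simp [Finset.sdiff_singleton_eq_erase, hL]
    · simp [hx]
  induction m generalizing L with
  | zero =>
    refine (hcont L (fun _ _ => rfl) (ColorableOn.mono h fun x _ => ?_)).mono (by omega)
    exact (hE L hw x).subset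
  | succ m ih =>
    rcases h with h | ⟨x, hx, h⟩
    · refine (hcont L (fun _ _ => rfl) (h.mono fun x _ => ?_)).mono (by omega)
      exact (hE L hw x).subset
    · rw [Nat.add_right_comm]
      refine Or.inr ⟨x, hS hx, fun c hc => ?_⟩
      have hagree : ∀ L' : V → Finset ℕ,
          (∀ y ∉ S', L' y = Function.update L x (insert c (L x)) y) → ∀ y ∉ S', L' y = L y :=
        fun L' hL' y hy => by rw [hL' y hy, Function.update_of_ne (by rintro rfl; exact hy hx)]
      by_cases hxe : x = w ∧ c = e
      · obtain ⟨rfl, rfl⟩ := hxe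
        refine ReqWins.add_of_sdiff hS (F := fun y => if y = x then {c} else ∅) (fun y => ?_) ?_
          fun L' hL' hcol => hcont L' (hagree L' hL') hcol
        · by_cases hyx : y = x
          · subst hyx; simp
          · simp [hyx]
        · refine ReqWins.congr (L := L) (Or.inr ⟨x, hx, h⟩) fun y _ => ?_
          by_cases hyx : y = x
          · subst hyx; simp [Finset.sdiff_singleton_eq_erase, hc]
          · simp [hyx]
      · refine ih ?_ (h c hc) fun L' hL' hcol => hcont L' (hagree L' hL') hcol
        by_cases hxw : w = x
        · subst hxw
          have : e ≠ c := fun h => hxe ⟨rfl, h.symm⟩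
          simp [this, hw]
        · simpa [hxw] using hw

variable {v w : V} {R : Finset V} {d φ : V → ℕ}

/-- Once the rest of the graph is colored by `φ` and a color `e ≠ φ w` for `v` is available,
Requester finishes by requesting a second color at every leaf whose only color is `e`. -/
theorem reqWins_of_card_filter_le {e : ℕ} (hleaf : ∀ ℓ ∈ R, ∀ y, G.Adj ℓ y → y = v)
    (hnbr : ∀ y, G.Adj v y → y ∉ R → y = w)
    (hφ : ∀ x ∈ Finset.univ \ insert v R, φ x ∈ L x)
    (hφ' : ∀ x ∈ Finset.univ \ insert v R, ∀ y ∈ Finset.univ \ insert v R,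
      G.Adj x y → φ x ≠ φ y)
    (hvR : v ∉ R) (hev : e ∈ L v) (hew : φ w ≠ e) (hne : ∀ ℓ ∈ R, (L ℓ).Nonempty)
    (hn : {ℓ ∈ R | L ℓ = {e}}.card ≤ n) : ReqWins G Finset.univ L n := by
  induction n generalizing L with
  | zero =>
    have hex : ∀ ℓ ∈ R, ∃ c ∈ L ℓ, c ≠ e := by
      intro ℓ hℓ
      by_contra! hall
      have := Finset.card_eq_zero.1 (Nat.le_zero.1 hn)
      exact Finset.filter_eq_empty_iff.1 this hℓ
        (Finset.eq_singleton_iff_nonempty_unique_mem.2 ⟨hne ℓ hℓ, hall⟩)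
    choose! g hg hge using hex
    have hout : ∀ x, x ≠ v → x ∉ R → x ∈ Finset.univ \ insert v R := fun x h1 h2 => by
      simp [h1, h2]
    refine ⟨fun x => if x = v then e else if x ∈ R then g x else φ x, fun x _ => ?_,
      fun x _ y _ hxy => ?_⟩
    · by_cases hxv : x = v
      · subst hxv; simpa using hev
      · by_cases hxR : x ∈ R
        · simpa [hxv, hxR] using hg x hxR
        · simpa [hxv, hxR] using hφ x (hout x hxv hxR)
    · by_cases hxv : x = v
      · subst hxv
        have hyv : y ≠ x := hxy.ne'
        by_cases hyR : y ∈ R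
        · simpa [hyv, hyR] using (hge y hyR).symm
        · obtain rfl := hnbr y hxy hyR
          simpa [hyv, hyR] using hew.symm
      · by_cases hxR : x ∈ R
        · obtain rfl := hleaf x hxR y hxy
          simpa [hxv, hxR] using hge x hxR
        · by_cases hyv : y = v
          · subst hyv
            obtain rfl := hnbr x hxy.symm hxR
            simpa [hxv, hxR] using hew
          · have hyR : y ∉ R := fun hyR => hxv (hleaf y hyR x hxy.symm)
            simpa [hxv, hxR, hyv, hyR] using hφ' x (hout x hxv hxR) y (hout y hyv hyR) hxy
  | succ n ih =>
    rcases Finset.eq_empty_or_nonempty {ℓ ∈ R | L ℓ = {e}} with h0 | ⟨ℓ, hℓ⟩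
    · exact (ih hφ hev hne (by simp [h0])).succ
    · have hℓ' := Finset.mem_filter.1 hℓ
      refine Or.inr ⟨ℓ, Finset.mem_univ _, fun c hc => ih (fun x hx => ?_) ?_ (fun x hx => ?_) ?_⟩
      · have hxℓ : x ≠ ℓ := by rintro rfl; simp [hℓ'.1] at hx
        simpa [hxℓ] using hφ x hx
      · have hxℓ : v ≠ ℓ := by rintro rfl; exact hvR hℓ'.1
        simpa [hxℓ] using hev
      · by_cases hxℓ : x = ℓ
        · subst hxℓ; simp
        · simpa [hxℓ] using hne x hx
      · rw [← Nat.lt_succ_iff]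
        refine lt_of_lt_of_le (Finset.card_lt_card ?_) hn
        have hnot : insert c (L ℓ) ≠ {e} := by
          rw [hℓ'.2] at hc ⊢
          intro h
          have : c ∈ ({e} : Finset ℕ) := h ▸ Finset.mem_insert_self c {e}
          exact hc this
        refine Finset.ssubset_iff_of_subset (fun x hx => ?_) |>.2 ⟨ℓ, hℓ, by simp [hnot]⟩
        have hx' := Finset.mem_filter.1 hx
        by_cases hxℓ : x = ℓ
        · subst hxℓ; exact hℓ
        · exact Finset.mem_filter.2 ⟨hx'.1, by simpa [hxℓ] using hx'.2⟩

theorem sum_card_fiber_le (R : Finset V) (d : V → ℕ) (C : Finset ℕ) :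
    ∑ c ∈ C, {ℓ ∈ R | d ℓ = c}.card ≤ R.card := by
  rw [← Finset.card_biUnion]
  · exact Finset.card_le_card (Finset.biUnion_subset.2 fun _ _ => Finset.filter_subset _ _)
  · intro a _ b _ hab
    refine Finset.disjoint_left.2 fun x hx hx' => hab ?_
    rw [← (Finset.mem_filter.1 hx).2, (Finset.mem_filter.1 hx').2]

theorem filter_singleton_congr (hd : ∀ ℓ ∈ R, L ℓ = {d ℓ}) (e : ℕ) :
    {ℓ ∈ R | L ℓ = {e}} = {ℓ ∈ R | d ℓ = e} :=
  Finset.filter_congr fun ℓ hℓ => by rw [hd ℓ hℓ, Finset.singleton_inj]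

/-- The end game in which `φ w` is already among the colors wasted on `v`. -/
theorem reqWins_of_tri_le_add_one {u : ℕ} (hvR : v ∉ R)
    (hleaf : ∀ ℓ ∈ R, ∀ y, G.Adj ℓ y → y = v) (hnbr : ∀ y, G.Adj v y → y ∉ R → y = w)
    (htop : R.card + 1 < tri (u + 1))
    (hφ' : ∀ x ∈ Finset.univ \ insert v R, ∀ y ∈ Finset.univ \ insert v R,
      G.Adj x y → φ x ≠ φ y) (q : ℕ)
    (hφ : ∀ x ∈ Finset.univ \ insert v R, φ x ∈ L x)
    (hd : ∀ ℓ ∈ R, L ℓ = {d ℓ}) (hwv : φ w ∈ L v)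
    (hsum : tri (u + 1) ≤ ∑ c ∈ L v, {ℓ ∈ R | d ℓ = c}.card + tri q + 1) :
    ReqWins G Finset.univ L q := by
  induction q generalizing L with
  | zero =>
    have := sum_card_fiber_le R d (L v)
    have h0 : tri 0 = 0 := by simp [tri]
    omega
  | succ q ih =>
    refine Or.inr ⟨v, Finset.mem_univ _, fun c hc => ?_⟩
    have hφu : ∀ x ∈ Finset.univ \ insert v R,
        φ x ∈ Function.update L v (insert c (L v)) x := by
      intro x hx
      have hxv : x ≠ v := by rintro rfl; simp at hx
      simpa [hxv] using hφ x hx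
    have hdu : ∀ ℓ ∈ R, Function.update L v (insert c (L v)) ℓ = {d ℓ} := by
      intro ℓ hℓ
      have hℓv : ℓ ≠ v := by rintro rfl; exact hvR hℓ
      simpa [hℓv] using hd ℓ hℓ
    by_cases hle : {ℓ ∈ R | d ℓ = c}.card ≤ q
    · refine reqWins_of_card_filter_le (e := c) hleaf hnbr hφu hφ' hvR (by simp)
        (by rintro rfl; exact hc hwv) (fun ℓ hℓ => by simp [hdu ℓ hℓ]) ?_
      rwa [filter_singleton_congr hdu]
    · refine ih hφu hdu (by simp [hwv]) ?_
      rw [Function.update_self, Finset.sum_insert hc]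
      rw [tri_succ q] at hsum
      omega

theorem reqWins_of_tri_le {u k : ℕ} {C : Finset ℕ} (hvR : v ∉ R) (hwR : w ∉ R) (hwv : w ≠ v)
    (hleaf : ∀ ℓ ∈ R, ∀ y, G.Adj ℓ y → y = v) (hnbr : ∀ y, G.Adj v y → y ∉ R → y = w)
    (htop : R.card + 1 < tri (u + 1)) (q : ℕ)
    (hwin : ReqWins G (Finset.univ \ insert v R) L k)
    (hd : ∀ ℓ ∈ R, L ℓ = {d ℓ}) (hw : L w = ∅) (hC : L v = C)
    (hsum : tri (u + 1) ≤ ∑ c ∈ C, {ℓ ∈ R | d ℓ = c}.card + tri q) :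
    ReqWins G Finset.univ L (k + q) := by
  subst hC
  induction q generalizing L with
  | zero =>
    have := sum_card_fiber_le R d (L v)
    have h0 : tri 0 = 0 := by simp [tri]
    omega
  | succ q ih =>
    refine Or.inr ⟨v, Finset.mem_univ _, fun c hc => ?_⟩
    rw [tri_succ q] at hsum
    set L₁ := Function.update L v (insert c (L v)) with hL₁
    have hL₁v : L₁ v = insert c (L v) := by simp [hL₁]
    have hwin₁ : ReqWins G (Finset.univ \ insert v R) L₁ k := by
      refine hwin.congr fun x hx => ?_
      have hxv : x ≠ v := by rintro rfl; simp at hx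
      simp [hL₁, hxv]
    have hd₁ : ∀ ℓ ∈ R, L₁ ℓ = {d ℓ} := by
      intro ℓ hℓ
      have hℓv : ℓ ≠ v := by rintro rfl; exact hvR hℓ
      simpa [hL₁, hℓv] using hd ℓ hℓ
    have hw₁ : L₁ w = ∅ := by simpa [hL₁, hwv] using hw
    have hwS : w ∈ Finset.univ \ insert v R := by simp [hwv, hwR]
    have hagree : ∀ L' : V → Finset ℕ, (∀ x ∉ Finset.univ \ insert v R, L' x = L₁ x) →
        L' v = insert c (L v) ∧ ∀ ℓ ∈ R, L' ℓ = {d ℓ} := by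
      intro L' hL'
      refine ⟨by rw [hL' v (by simp), hL₁v], fun ℓ hℓ => ?_⟩
      rw [hL' ℓ (by simp [hℓ]), hd₁ ℓ hℓ]
    rcases lt_trichotomy {ℓ ∈ R | d ℓ = c}.card q with hlt | heq | hgt
    · rw [show k.add q = k + 1 + (q - 1) by rw [Nat.add_eq]; omega]
      refine hwin₁.add_of_notMem (Finset.subset_univ _) (w := w) (e := c) (by simp [hw₁]) ?_
      rintro L' hL' ⟨φ, hφ, hφ'⟩
      obtain ⟨hv', hd'⟩ := hagree L' hL'
      refine reqWins_of_card_filter_le (e := c) hleaf hnbr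
        (fun x hx => (Finset.mem_sdiff.1 (hφ x hx)).1) hφ' hvR (by simp [hv']) ?_
        (fun ℓ hℓ => by simp [hd' ℓ hℓ]) ?_
      · simpa using (Finset.mem_sdiff.1 (hφ w hwS)).2
      · rw [filter_singleton_congr hd']; omega
    · refine ReqWins.add_of_sdiff (S' := Finset.univ \ insert v R) (Finset.subset_univ _)
        (F := fun _ => ∅) (fun _ => Finset.empty_subset _) (by simpa using hwin₁) ?_
      rintro L' hL' ⟨φ, hφ, hφ'⟩
      obtain ⟨hv', hd'⟩ := hagree L' hL'
      have hφ₁ : ∀ x ∈ Finset.univ \ insert v R, φ x ∈ L' x := fun x hx =>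
        (Finset.mem_sdiff.1 (hφ x hx)).1
      by_cases hφc : φ w = c
      · refine reqWins_of_tri_le_add_one hvR hleaf hnbr htop hφ' q hφ₁ hd' (by simp [hv', hφc]) ?_
        rw [hv', Finset.sum_insert hc]
        omega
      · refine reqWins_of_card_filter_le (e := c) hleaf hnbr hφ₁ hφ' hvR (by simp [hv']) hφc
          (fun ℓ hℓ => by simp [hd' ℓ hℓ]) ?_
        rw [filter_singleton_congr hd']; omega
    · refine ih hwin₁ hd₁ hw₁ ?_
      rw [hL₁v, Finset.sum_insert hc]
      omega

theorem exists_fiber_card_ge (u : ℕ) (R : Finset V) (h : tri u ≤ R.card) :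
    ∃ f : V → ℕ, ∀ i, u - i ≤ {ℓ ∈ R | f ℓ = i}.card := by
  induction u generalizing R with
  | zero => exact ⟨fun _ => 0, by simp⟩
  | succ u ih =>
    rw [tri_succ] at h
    obtain ⟨A, hAR, hA⟩ := Finset.exists_subset_card_eq (s := R) (n := u + 1) (by omega)
    obtain ⟨f, hf⟩ := ih (R \ A) (by rw [Finset.card_sdiff_of_subset hAR]; omega)
    refine ⟨fun x => if x ∈ A then 0 else f x + 1, fun i => ?_⟩
    cases i with
    | zero =>
      rw [Nat.sub_zero, ← hA]
      exact Finset.card_le_card fun x hx => Finset.mem_filter.2 ⟨hAR hx, by simp [hx]⟩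
    | succ i =>
      rw [Nat.add_sub_add_right]
      refine (hf i).trans (Finset.card_le_card fun x hx => ?_)
      simp only [Finset.mem_filter, Finset.mem_sdiff] at hx ⊢
      exact ⟨hx.1.1, by simp [hx.1.2, hx.2]⟩

/-- If Supplier hands out `0, 1, 2, …` at the center `v` of a star and `f ℓ` as first color of each
leaf `ℓ`, a proper coloring of the star takes at least `|R| + u + 1` rounds. -/
theorem ColorableOn.le_card_add_sum {u : ℕ} {f : V → ℕ} (hadj : ∀ ℓ ∈ R, G.Adj v ℓ)
    (hf : ∀ i, u - i ≤ {ℓ ∈ R | f ℓ = i}.card) (h : ColorableOn G Finset.univ L)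
    (hv : L v = Finset.range (L v).card) (hfL : ∀ ℓ ∈ R, L ℓ = ∅ ∨ f ℓ ∈ L ℓ) :
    R.card + u + 1 ≤ (L v).card + ∑ ℓ ∈ R, (L ℓ).card := by
  obtain ⟨φ, h1, h2⟩ := h
  have hφv : φ v < (L v).card := by
    have := h1 v (Finset.mem_univ _)
    rw [hv] at this
    exact Finset.mem_range.1 this
  have hsum : R.card + {ℓ ∈ R | f ℓ = φ v}.card ≤ ∑ ℓ ∈ R, (L ℓ).card := by
    rw [Finset.card_eq_sum_ones, Finset.card_filter, ← Finset.sum_add_distrib]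
    refine Finset.sum_le_sum fun ℓ hℓ => ?_
    have hmem := h1 ℓ (Finset.mem_univ _)
    split_ifs with hfv
    · have hfm : f ℓ ∈ L ℓ := (hfL ℓ hℓ).resolve_left (Finset.ne_empty_of_mem hmem)
      refine Finset.one_lt_card.2 ⟨_, hmem, _, hfm, ?_⟩
      rw [hfv]
      exact (h2 v (Finset.mem_univ _) ℓ (Finset.mem_univ _) (hadj ℓ hℓ)).symm
    · exact Finset.card_pos.2 ⟨_, hmem⟩
  have := hf (φ v)
  omega

/-- Supplier can play on the star formed by `v` and `R` independently of the rest. -/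
theorem exists_reqWins_add_le {u : ℕ} {f : V → ℕ} (hvR : v ∉ R) (hadj : ∀ ℓ ∈ R, G.Adj v ℓ)
    (hf : ∀ i, u - i ≤ {ℓ ∈ R | f ℓ = i}.card) (n : ℕ) (L : V → Finset ℕ)
    (h : ReqWins G Finset.univ L n)
    (hv : L v = Finset.range (L v).card) (hfL : ∀ ℓ ∈ R, L ℓ = ∅ ∨ f ℓ ∈ L ℓ) :
    ∃ m, ReqWins G (Finset.univ \ insert v R) L m ∧
      m + (R.card + u + 1) ≤ n + ((L v).card + ∑ ℓ ∈ R, (L ℓ).card) := by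
  have hbase : ∀ n L, ColorableOn G Finset.univ L → L v = Finset.range (L v).card →
      (∀ ℓ ∈ R, L ℓ = ∅ ∨ f ℓ ∈ L ℓ) → ∃ m, ReqWins G (Finset.univ \ insert v R) L m ∧
      m + (R.card + u + 1) ≤ n + ((L v).card + ∑ ℓ ∈ R, (L ℓ).card) := by
    intro n L h hv hfL
    have := h.le_card_add_sum hadj hf hv hfL
    exact ⟨0, h.subset (Finset.subset_univ _), by omega⟩
  induction n generalizing L with
  | zero => exact hbase 0 L h hv hfL
  | succ n ih =>
    rcases h with h | ⟨x, -, h⟩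
    · exact hbase _ L h hv hfL
    by_cases hxv : x = v
    · subst hxv
      have hnew : (L x).card ∉ L x := by rw [hv]; simp
      have hR : ∀ ℓ ∈ R, ℓ ≠ x := by rintro ℓ hℓ rfl; exact hvR hℓ
      obtain ⟨m, hm, hle⟩ := ih _ (h _ hnew)
        (by
          rw [Function.update_self, Finset.card_insert_of_notMem hnew, Finset.range_add_one, ← hv])
        (fun ℓ hℓ => by simpa [hR ℓ hℓ] using hfL ℓ hℓ)
      refine ⟨m, hm.congr fun y hy => ?_, ?_⟩
      · rw [Function.update_of_ne]; rintro rfl; simp at hy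
      · rw [Function.update_self, Finset.card_insert_of_notMem hnew, Finset.sum_congr rfl
          fun ℓ hℓ => by rw [Function.update_of_ne (hR ℓ hℓ)]] at hle
        omega
    by_cases hxR : x ∈ R
    · obtain ⟨c, hc, hcf⟩ : ∃ c ∉ L x, f x ∈ insert c (L x) := by
        by_cases hfx : f x ∈ L x
        · obtain ⟨c, hc⟩ := Infinite.exists_notMem_finset (L x)
          exact ⟨c, hc, Finset.mem_insert_of_mem hfx⟩
        · exact ⟨f x, hfx, Finset.mem_insert_self _ _⟩
      obtain ⟨m, hm, hle⟩ := ih _ (h c hc)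
        (by simpa [Ne.symm hxv] using hv)
        (fun ℓ hℓ => by
          by_cases hℓx : ℓ = x
          · subst hℓx; right; simpa using hcf
          · simpa [hℓx] using hfL ℓ hℓ)
      refine ⟨m, hm.congr fun y hy => ?_, ?_⟩
      · rw [Function.update_of_ne]; rintro rfl; simp [hxR] at hy
      · rw [Function.update_of_ne (Ne.symm hxv), ← Finset.add_sum_erase _ _ hxR,
          Function.update_self, Finset.card_insert_of_notMem hc, Finset.sum_congr rfl
          fun ℓ hℓ => by rw [Function.update_of_ne (Finset.ne_of_mem_erase hℓ)]] at hle
        rw [← Finset.add_sum_erase _ _ hxR]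
        omega
    · have hR : ∀ ℓ ∈ R, ℓ ≠ x := by rintro ℓ hℓ rfl; exact hxR hℓ
      have key : ∀ c ∉ L x, ∃ m,
          ReqWins G (Finset.univ \ insert v R) (Function.update L x (insert c (L x))) m ∧
          m + (R.card + u + 1) ≤ n + ((L v).card + ∑ ℓ ∈ R, (L ℓ).card) := by
        intro c hc
        obtain ⟨m, hm, hle⟩ := ih _ (h c hc) (by simpa [Ne.symm hxv] using hv)
          (fun ℓ hℓ => by simpa [hR ℓ hℓ] using hfL ℓ hℓ)
        refine ⟨m, hm, ?_⟩
        rwa [Function.update_of_ne (Ne.symm hxv), Finset.sum_congr rfl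
          fun ℓ hℓ => by rw [Function.update_of_ne (hR ℓ hℓ)]] at hle
      obtain ⟨c, hc⟩ := Infinite.exists_notMem_finset (L x)
      obtain ⟨m, -, hle⟩ := key c hc
      refine ⟨n + ((L v).card + ∑ ℓ ∈ R, (L ℓ).card) - (R.card + u + 1) + 1,
        Or.inr ⟨x, by simp [hxv, hxR], fun c hc => ?_⟩, by omega⟩
      obtain ⟨m, hm, hle'⟩ := key c hc
      exact hm.mono (by omega)

/-- If `v` is a stem with a non-leaf neighbor in a forest `T`, with `r ≥ 1` leaf
neighbors (forming the set `R`), and `r + 1` is not triangular, then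
`χ_ISC(T) = χ_ISC(T - R - v) + r + u_r + 1`. -/
theorem stmt16 (G : SimpleGraph V) (hG : G.IsAcyclic) (v : V) (R : Finset V)
    (hv : IsStem G v) (hw : ∃ w, G.Adj v w ∧ ¬ IsLeaf G w)
    (hR : ∀ w, w ∈ R ↔ (G.Adj v w ∧ IsLeaf G w)) (hr : 1 ≤ R.card)
    (htri : ¬ IsTriangular (R.card + 1)) :
    isc G Finset.univ =
      isc G (Finset.univ \ insert v R) + R.card + uval R.card + 1 := by
  obtain ⟨w, hvw, hwl⟩ := hw
  have hvR : v ∉ R := fun h => G.irrefl ((hR v).1 h).1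
  have hwR : w ∉ R := fun h => hwl ((hR w).1 h).2
  have hleaf : ∀ ℓ ∈ R, ∀ y, G.Adj ℓ y → y = v := by
    intro ℓ hℓ y hy
    obtain ⟨hvℓ, hl⟩ := (hR ℓ).1 hℓ
    obtain ⟨a, ha⟩ := Set.ncard_eq_one.1 hl
    have h1 : y ∈ G.neighborSet ℓ := hy
    have h2 : v ∈ G.neighborSet ℓ := hvℓ.symm
    rw [ha] at h1 h2
    rw [Set.mem_singleton_iff.1 h1, Set.mem_singleton_iff.1 h2]
  have hnbr : ∀ y, G.Adj v y → y ∉ R → y = w := by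
    intro y hy hyR
    have hyl : ¬ IsLeaf G y := fun h => hyR ((hR y).2 ⟨hy, h⟩)
    exact (Set.ncard_le_one (Set.toFinite _)).1 hv.2 y ⟨hy, hyl⟩ w ⟨hvw, hwl⟩
  have hadj : ∀ ℓ ∈ R, G.Adj v ℓ := fun ℓ hℓ => ((hR ℓ).1 hℓ).1
  have hup : ReqWins G Finset.univ (fun _ => ∅)
      (isc G (Finset.univ \ insert v R) + R.card + uval R.card + 1) := by
    have htop : R.card + 1 < tri (uval R.card + 1) :=
      lt_of_le_of_ne (card_lt_tri_uval_succ R.card) fun h => htri ⟨_, h⟩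
    have := reqWins_add_card (G := G) (S := Finset.univ) (n := isc G (Finset.univ \ insert v R)
      + (uval R.card + 1)) R (fun _ _ => Finset.mem_univ _) (fun _ => ∅) (fun _ _ => rfl) ?_
    · exact this.mono (by omega)
    · intro d
      refine reqWins_of_tri_le (d := d) hvR hwR hvw.ne' hleaf hnbr htop (C := ∅) _ ?_ ?_ ?_ ?_ ?_
      · refine (reqWins_isc G (Finset.univ \ insert v R)).congr fun x hx => ?_
        simp only [Finset.mem_sdiff, Finset.mem_insert, not_or] at hx
        simp [hx.2.2]
      · intro ℓ hℓ; simp [hℓ]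
      · simp [hwR]
      · simp [hvR]
      · simp
  refine le_antisymm (Nat.sInf_le hup) ?_
  obtain ⟨f, hf⟩ := exists_fiber_card_ge (uval R.card) R (tri_uval_le R.card)
  obtain ⟨m, hm, hle⟩ := exists_reqWins_add_le hvR hadj hf _ _
    (reqWins_isc G Finset.univ) (by simp) (by simp)
  have hmin : isc G (Finset.univ \ insert v R) ≤ m := Nat.sInf_le hm
  simp only [Finset.card_empty, Finset.sum_const_zero] at hle
  omega
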